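/- Let T be a finite tree (a connected acyclic multigraph). For each edge e of T, let V_e ⊆ Verts(T) be the vertex set of one of the two connected components of the graph obtained from T by deleting e. Then for every integer a and every family of integers (a_e)_{e ∈ Edges(T)}, there exists exactly one x ∈ ℤ^{Verts(T)} such that Σ_{v ∈ Verts(T)} x(v) = a and Σ_{v ∈ V_e} x(v) = a_e for every edge e of T. -/

import Mathlib

open Finset

variable {V E : Type} [Fintype V] [Fintype E] [DecidableEq V] [DecidableEq E]

/-- The unordered pair of endpoints of an edge. -/
def eSym (ends : E → V × V) (e : E) : Sym2 V := s((ends e).1, (ends e).2)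

/-- Reachability in the spanning subgraph with edge set `A`. -/
def Linked (ends : E → V × V) (A : Finset E) : V → V → Prop :=
  Relation.ReflTransGen (fun v w => ∃ e ∈ A, eSym ends e = s(v, w))

/-- The spanning subgraph with edge set `A` is connected. -/
def Conn (ends : E → V × V) (A : Finset E) : Prop :=
  Nonempty V ∧ ∀ v w : V, Linked ends A v w

/-- The induced subgraph on the vertex set `W` is connected. -/
def ConnOn (ends : E → V × V) (W : Finset V) : Prop :=
  W.Nonempty ∧ ∀ v ∈ W, ∀ w ∈ W,
    Relation.ReflTransGen (fun a b => a ∈ W ∧ b ∈ W ∧ ∃ e : E, eSym ends e = s(a, b)) v w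

/-- A spanning tree: a connected spanning subgraph with `|V| - 1` edges. -/
def IsSpanningTree (ends : E → V × V) (A : Finset E) : Prop :=
  Conn ends A ∧ A.card + 1 = Fintype.card V

/-- The complexity of the spanning subgraph `A`: the number of its spanning trees. -/
noncomputable def complexity (ends : E → V × V) (A : Finset E) : ℕ :=
  Nat.card {T : Finset E // T ⊆ A ∧ IsSpanningTree ends T}

/-- `n(G)`: the number of edges of `Γ` missing from the spanning subgraph `G`. -/
def nG (A : Finset E) : ℕ := (Finset.univ \ A).card

/-- The space of multidegrees of total degree `d` at `A`. -/
def Sdeg (d : ℤ) (A : Finset E) : Set (V → ℤ) :=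
  {x | ∑ v, x v = d - (nG A : ℤ)}

/-- The twister at vertex `v` of the spanning subgraph with edge set `A`. -/
def twVec (ends : E → V × V) (A : Finset E) (v : V) : V → ℤ := fun w =>
  if w = v then
    -((A.filter (fun e => v ∈ eSym ends e ∧ ¬(eSym ends e).IsDiag)).card : ℤ)
  else ((A.filter (fun e => eSym ends e = s(v, w))).card : ℤ)

/-- The twister (chip-firing) group of the spanning subgraph with edge set `A`. -/
def twGroup (ends : E → V × V) (A : Finset E) : AddSubgroup (V → ℤ) :=
  AddSubgroup.closure (Set.range (twVec ends A))

/-- The standard basis vector at `v`. -/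
def stdVec (v : V) : V → ℤ := fun w => if w = v then 1 else 0

/-- A degree-`d` assignment: supported on connected spanning subgraphs, with the
prescribed total degree. -/
def IsAssignment (ends : E → V × V) (d : ℤ) (σ : Finset E → Set (V → ℤ)) : Prop :=
  ∀ A : Finset E, ∀ x ∈ σ A, Conn ends A ∧ x ∈ Sdeg d A

/-- Condition (1), chip-adding. -/
def ChipAdding (ends : E → V × V) (σ : Finset E → Set (V → ℤ)) : Prop :=
  ∀ A : Finset E, ∀ x ∈ σ A, ∀ e ∉ A, ∀ v ∈ eSym ends e, x + stdVec v ∈ σ (insert e A)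

/-- `S` is a minimal complete set of representatives for the action of the twister group
of `A` on the multidegree space `S^d(A)`. -/
def IsRepSet (ends : E → V × V) (d : ℤ) (A : Finset E) (S : Set (V → ℤ)) : Prop :=
  S ⊆ Sdeg d A ∧ ∀ x ∈ Sdeg (E := E) d A, ∃! y, y ∈ S ∧ x - y ∈ twGroup ends A

/-- A degree-`d` stability assignment. -/
def IsStabilityAssignment (ends : E → V × V) (d : ℤ) (σ : Finset E → Set (V → ℤ)) : Prop :=
  IsAssignment ends d σ ∧ ChipAdding ends σ ∧
    ∀ A : Finset E, Conn ends A → IsRepSet ends d A (σ A)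

/-- Vertices of the subdivision `Γ̃_m`: original vertices plus, for each edge `e`,
`m e` exceptional vertices. -/
abbrev SubV (V E : Type) (m : E → ℕ) : Type := V ⊕ (Σ e : E, Fin (m e))

/-- Edges of the subdivision `Γ̃_m`: each edge `e` is replaced by a chain of `m e + 1` edges. -/
abbrev SubE (E : Type) (m : E → ℕ) : Type := Σ e : E, Fin (m e + 1)

/-- The `i`-th vertex along the chain replacing the edge `e` in the subdivision. -/
def subNode (ends : E → V × V) (m : E → ℕ) (e : E) (i : ℕ) : SubV V E m :=
  if h0 : i = 0 then Sum.inl (ends e).1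
  else if h : i ≤ m e then Sum.inr ⟨e, ⟨i - 1, by omega⟩⟩
  else Sum.inl (ends e).2

/-- The endpoints of the edges of the subdivision `Γ̃_m`. -/
def subEnds (ends : E → V × V) (m : E → ℕ) : SubE E m → SubV V E m × SubV V E m :=
  fun p => (subNode ends m p.1 p.2.val, subNode ends m p.1 (p.2.val + 1))

/-- The lift of the multidegree `x` on `(A, Γ)`: extend by zero and add one chip on
the exceptional vertex `t e` of every removed edge `e ∉ A`. -/
def liftOf (m : E → ℕ) (A : Finset E) (x : V → ℤ) (t : E → ℕ) : SubV V E m → ℤ :=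
  Sum.elim x fun p => if p.1 ∉ A ∧ (p.2 : ℕ) = t p.1 then 1 else 0

/-- The lift `σ̃_m` of an assignment `σ`: all lifts of all elements of `σ`. -/
def liftSet (m : E → ℕ) (σ : Finset E → Set (V → ℤ)) : Set (SubV V E m → ℤ) :=
  {y | ∃ (A : Finset E) (x : V → ℤ) (t : E → ℕ),
    x ∈ σ A ∧ (∀ e ∉ A, t e < m e) ∧ y = liftOf m A x t}

/-- Edges with both endpoints in `W` (the edges of the induced subgraph `Γ(W)`). -/
def inE (ends : E → V × V) (W : Finset V) : Finset E :=
  Finset.univ.filter fun e => (ends e).1 ∈ W ∧ (ends e).2 ∈ W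

/-- Edges with one endpoint in `W` and the other in `Wᶜ`. -/
def cutE (ends : E → V × V) (W : Finset V) : Finset E :=
  Finset.univ.filter fun e =>
    ((ends e).1 ∈ W ∧ (ends e).2 ∉ W) ∨ ((ends e).1 ∉ W ∧ (ends e).2 ∈ W)

/-- `φ`-semistability of the multidegree `x` on the spanning subgraph `A`. -/
def PhiSemistable (ends : E → V × V) (φ : V → ℝ) (A : Finset E) (x : V → ℤ) : Prop :=
  ∀ W : Finset V, W.Nonempty → W ≠ Finset.univ →
    |(∑ v ∈ W, ((x v : ℝ) - φ v)) + (((Finset.univ \ A) ∩ inE ends W).card : ℝ) +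
        (((Finset.univ \ A) ∩ cutE ends W).card : ℝ) / 2| ≤
      ((A ∩ cutE ends W).card : ℝ) / 2

/-- `φ`-stability of the multidegree `x` on the spanning subgraph `A`. -/
def PhiStable (ends : E → V × V) (φ : V → ℝ) (A : Finset E) (x : V → ℤ) : Prop :=
  ∀ W : Finset V, W.Nonempty → W ≠ Finset.univ →
    |(∑ v ∈ W, ((x v : ℝ) - φ v)) + (((Finset.univ \ A) ∩ inE ends W).card : ℝ) +
        (((Finset.univ \ A) ∩ cutE ends W).card : ℝ) / 2| <
      ((A ∩ cutE ends W).card : ℝ) / 2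

/-- Nondegeneracy of a numerical polarization `φ`. -/
def Nondegenerate (ends : E → V × V) (d : ℤ) (φ : V → ℝ) : Prop :=
  ∀ A : Finset E, ∀ x ∈ Sdeg d A, PhiSemistable ends φ A x → PhiStable ends φ A x

/-- The assignment `stab_{Γ,φ}` associated with a numerical polarization `φ`. -/
def stabAssign (ends : E → V × V) (d : ℤ) (φ : V → ℝ) : Finset E → Set (V → ℤ) :=
  fun A => {x | Conn ends A ∧ x ∈ Sdeg d A ∧ PhiSemistable ends φ A x}

/-- The valence of the vertex `v` (loops counted twice). -/
def valence (ends : E → V × V) (v : V) : ℕ :=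
  ∑ e : E, ((if (ends e).1 = v then 1 else 0) + (if (ends e).2 = v then 1 else 0))

/-- `x` is an integral break divisor for the connected spanning subgraph `A`. -/
def isIBD (ends : E → V × V) (gen : V → ℕ) (A : Finset E) (x : V → ℤ) : Prop :=
  ∃ T : Finset E, T ⊆ A ∧ IsSpanningTree ends T ∧
    ∃ t : E → V, (∀ e ∈ A \ T, t e ∈ eSym ends e) ∧
      x = fun v => (gen v : ℤ) + (((A \ T).filter fun e => t e = v).card : ℤ)

/-- The multidegree `(a, b)` on a two-vertex graph with first vertex `v₁`. -/
def pairFn (v₁ : V) (a b : ℤ) : V → ℤ := fun w => if w = v₁ then a else b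

omit [Fintype V] [Fintype E] [DecidableEq V] [DecidableEq E] in
theorem Linked.symm {ends : E → V × V} {A : Finset E} {v w : V} (h : Linked ends A v w) :
    Linked ends A w v := by
  have : Std.Symm (fun v w => ∃ e ∈ A, eSym ends e = s(v, w)) :=
    ⟨fun _ _ ⟨e, he, hxy⟩ => ⟨e, he, hxy.trans Sym2.eq_swap⟩⟩
  exact Relation.ReflTransGen.stdSymm.symm _ _ h

omit [Fintype V] [Fintype E] [DecidableEq V] [DecidableEq E] in
theorem linked_ends {ends : E → V × V} {A : Finset E} {e : E} (he : e ∈ A) :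
    Linked ends A (ends e).1 (ends e).2 :=
  Relation.ReflTransGen.single ⟨e, he, rfl⟩

omit [Fintype E] [DecidableEq V] [DecidableEq E] in
/-- A connected multigraph has at most one more vertex than it has edges. -/
theorem Conn.card_le {ends : E → V × V} {A : Finset E} (h : Conn ends A) :
    Fintype.card V ≤ A.card + 1 := by
  classical
  let G : SimpleGraph V := SimpleGraph.fromEdgeSet (eSym ends '' A)
  have hreach : ∀ v w, Linked ends A v w → G.Reachable v w := by
    intro v w hvw
    induction hvw with
    | refl => exact SimpleGraph.Reachable.refl _
    | @tail x y _ hxy ih =>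
      obtain rfl | hne := eq_or_ne x y
      · exact ih
      · obtain ⟨e, he, hxy⟩ := hxy
        exact ih.trans (SimpleGraph.Adj.reachable
          ((SimpleGraph.fromEdgeSet_adj _).2 ⟨⟨e, he, hxy⟩, hne⟩))
  have := h.1
  have hG : G.Connected := ⟨fun v w => hreach v w (h.2 v w)⟩
  have hV := hG.card_vert_le_card_edgeSet_add_one
  have hsub : G.edgeSet ⊆ eSym ends '' A := by
    rw [SimpleGraph.edgeSet_fromEdgeSet]
    exact Set.sdiff_subset
  have hE : Nat.card G.edgeSet ≤ A.card := by
    rw [Nat.card_coe_set_eq]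
    calc G.edgeSet.ncard ≤ (eSym ends '' (A : Set E)).ncard :=
          Set.ncard_le_ncard hsub (A.finite_toSet.image _)
      _ ≤ (A : Set E).ncard := Set.ncard_image_le A.finite_toSet
      _ = A.card := Set.ncard_coe_finset A
  rw [Nat.card_eq_fintype_card] at hV
  omega

omit [Fintype V] [Fintype E] [DecidableEq V] in
/-- Deleting an edge whose endpoints remain linked preserves connectedness. -/
theorem Conn.erase {ends : E → V × V} {A : Finset E} (h : Conn ends A) {e : E}
    (he : Linked ends (A.erase e) (ends e).1 (ends e).2) : Conn ends (A.erase e) := by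
  refine ⟨h.1, fun v w => ?_⟩
  have hvw := h.2 v w
  induction hvw with
  | refl => exact Relation.ReflTransGen.refl
  | @tail x y _ hxy ih =>
    obtain ⟨f, hf, hxy⟩ := hxy
    refine Relation.ReflTransGen.trans ih ?_
    by_cases hfe : f = e
    · subst hfe
      rcases Sym2.eq_iff.1 hxy with ⟨rfl, rfl⟩ | ⟨rfl, rfl⟩
      · exact he
      · exact he.symm
    · exact Relation.ReflTransGen.single ⟨f, Finset.mem_erase.2 ⟨hfe, hf⟩, hxy⟩

omit [DecidableEq V] in
/-- Every edge of a tree is a bridge. -/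
theorem not_linked_erase {ends : E → V × V} (hconn : Conn ends (Finset.univ : Finset E))
    (htree : Fintype.card E + 1 = Fintype.card V) (e : E) :
    ¬ Linked ends (Finset.univ.erase e) (ends e).1 (ends e).2 := by
  intro h
  have hle := (hconn.erase h).card_le
  have hpos : 0 < Fintype.card E := Fintype.card_pos_iff.2 ⟨e⟩
  rw [Finset.card_erase_of_mem (Finset.mem_univ e), Finset.card_univ] at hle
  omega

/-- The linear map sending a multidegree to its total degree and its partial degrees on the
vertex sets `S e`. -/
def partialDegrees (S : E → Finset V) : (V → ℤ) →ₗ[ℤ] (Option E → ℤ) where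
  toFun x o := ∑ v ∈ o.elim Finset.univ S, x v
  map_add' x y := by
    funext o
    simp [Finset.sum_add_distrib]
  map_smul' c x := by
    funext o
    simp [Finset.mul_sum]

omit [Fintype E] [DecidableEq E] in
theorem partialDegrees_single (S : E → Finset V) (v : V) (o : Option E) :
    partialDegrees S (Pi.single v 1) o = if v ∈ o.elim Finset.univ S then 1 else 0 := by
  simp [partialDegrees]

/-- If each edge `e` is the only edge whose endpoints are separated by `S e`, then the partial
degrees can be prescribed arbitrarily. -/
theorem partialDegrees_surjective [Nonempty V] {ends : E → V × V} {S : E → Finset V}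
    (hsep : ∀ e, ¬ ((ends e).1 ∈ S e ↔ (ends e).2 ∈ S e))
    (hne : ∀ e f, f ≠ e → ((ends f).1 ∈ S e ↔ (ends f).2 ∈ S e)) :
    Function.Surjective (partialDegrees S) := by
  have hedge : ∀ e : E, Pi.single (some e) (1 : ℤ) ∈ LinearMap.range (partialDegrees S) := by
    intro e
    have hdiff : ∃ c : ℤ, partialDegrees S
        (c • (Pi.single (ends e).1 1 - Pi.single (ends e).2 1)) = Pi.single (some e) 1 := by
      refine ⟨if (ends e).1 ∈ S e then 1 else -1, ?_⟩
      funext o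
      rw [map_smul, map_sub, Pi.smul_apply, Pi.sub_apply, partialDegrees_single,
        partialDegrees_single]
      rcases o with _ | f
      · simp
      · obtain rfl | hfe := eq_or_ne f e
        · have := hsep f
          by_cases h1 : (ends f).1 ∈ S f <;> by_cases h2 : (ends f).2 ∈ S f <;>
            simp_all
        · have := hne f e hfe.symm
          by_cases h2 : (ends e).2 ∈ S f <;> simp [this, hfe, h2]
    obtain ⟨c, hc⟩ := hdiff
    exact ⟨_, hc⟩
  have hnone : Pi.single none (1 : ℤ) ∈ LinearMap.range (partialDegrees S) := by
    obtain ⟨r⟩ := ‹Nonempty V›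
    have heq : (Pi.single none (1 : ℤ) : Option E → ℤ) = partialDegrees S (Pi.single r 1) -
        ∑ e, partialDegrees S (Pi.single r 1) (some e) • Pi.single (some e) (1 : ℤ) := by
      funext o
      rcases o with _ | f <;>
        simp [partialDegrees_single, Finset.sum_apply, Pi.single_apply]
    rw [heq]
    exact sub_mem ⟨_, rfl⟩ (sum_mem fun e _ => Submodule.smul_mem _ _ (hedge e))
  intro y
  have hy : y = ∑ o, y o • Pi.single o (1 : ℤ) := by
    funext o
    simp [Finset.sum_apply, Pi.single_apply]
  change y ∈ LinearMap.range (partialDegrees S)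
  rw [hy]
  refine sum_mem fun o _ => Submodule.smul_mem _ _ ?_
  rcases o with _ | e
  · exact hnone
  · exact hedge e

/-- Let `T` be a finite tree and for each edge `e` let `Ve e` be the
vertex set of one of the two connected components of `T ∖ e`. Then for every `a : ℤ` and
every family `b : E → ℤ`, there is exactly one `x ∈ ℤ^{Verts(T)}` with total sum `a` and
`Σ_{v ∈ Ve e} x v = b e` for every edge `e`. -/
theorem statement15 (ends : E → V × V)
    (hconn : Conn ends (Finset.univ : Finset E))
    (htree : Fintype.card E + 1 = Fintype.card V)
    (Ve : E → Finset V)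
    (hVe : ∀ e : E,
      (∀ v : V, v ∈ Ve e ↔ Linked ends (Finset.univ.erase e) (ends e).1 v) ∨
      (∀ v : V, v ∈ Ve e ↔ Linked ends (Finset.univ.erase e) (ends e).2 v))
    (a : ℤ) (b : E → ℤ) :
    ∃! x : V → ℤ, (∑ v : V, x v = a) ∧ ∀ e : E, ∑ v ∈ Ve e, x v = b e := by
  have := hconn.1
  have hbridge := not_linked_erase hconn htree
  have hsep : ∀ e, ¬ ((ends e).1 ∈ Ve e ↔ (ends e).2 ∈ Ve e) := by
    intro e hiff
    rcases hVe e with h | h <;> rw [h, h] at hiff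
    · exact hbridge e (hiff.1 Relation.ReflTransGen.refl)
    · exact hbridge e (hiff.2 Relation.ReflTransGen.refl).symm
  have hne : ∀ e f, f ≠ e → ((ends f).1 ∈ Ve e ↔ (ends f).2 ∈ Ve e) := by
    intro e f hfe
    have hf : Linked ends (Finset.univ.erase e) (ends f).1 (ends f).2 :=
      linked_ends (Finset.mem_erase.2 ⟨hfe, Finset.mem_univ f⟩)
    rcases hVe e with h | h <;> rw [h, h] <;>
      exact ⟨fun h' => h'.trans hf, fun h' => h'.trans hf.symm⟩
  have hsurj := partialDegrees_surjective hsep hne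
  have hcard : Fintype.card (Option E) = Fintype.card V := by
    rw [Fintype.card_option, htree]
  let φ : (Option E → ℤ) ≃ₗ[ℤ] (V → ℤ) :=
    LinearEquiv.funCongrLeft ℤ ℤ (Fintype.equivOfCardEq hcard).symm
  have hinj : Function.Injective (partialDegrees Ve) := by
    have := OrzechProperty.injective_of_surjective_endomorphism
      (φ.toLinearMap ∘ₗ partialDegrees Ve) (φ.surjective.comp hsurj)
    exact Function.Injective.of_comp (f := φ) this
  obtain ⟨x, hx, huniq⟩ := Function.Bijective.existsUnique ⟨hinj, hsurj⟩
    (fun o : Option E => o.elim a b)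
  refine ⟨x, ⟨congrFun hx none, fun e => congrFun hx (some e)⟩, ?_⟩
  rintro y ⟨hy, hy'⟩
  apply huniq
  funext o
  rcases o with _ | e
  · exact hy
  · exact hy' e
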